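/- Let x be odd with x ≥ 3 and let y be an integer with y > x and y > 2x − 2. If a ≥ 4x − 3, b ≥ y − 2x + 2 and c ≥ 0, then the multiset {1^a, x^b, y^c} has a linear realization. -/

import Mathlib

/-- The multiset of absolute differences of consecutive entries of a list of naturals. -/
def linDiffs (l : List ℕ) : Multiset ℕ :=
  ↑(List.zipWith (fun a b => (a - b) + (b - a)) l l.tail)

/-- `l` is a linear realization of the multiset `L`: it lists `0, …, |L|`
(each exactly once) and its consecutive absolute differences form `L`. -/
def IsLinearRealization (L : Multiset ℕ) (l : List ℕ) : Prop :=
  l.Perm (List.range (Multiset.card L + 1)) ∧ linDiffs l = L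

def HasLinearRealization (L : Multiset ℕ) : Prop :=
  ∃ l : List ℕ, IsLinearRealization L l

/-- A standard linear realization starts at `0`. -/
def HasStandardLinearRealization (L : Multiset ℕ) : Prop :=
  ∃ l : List ℕ, IsLinearRealization L l ∧ l.head? = some 0

/-- A perfect linear realization starts at `0` and ends at `v - 1 = |L|`. -/
def HasPerfectLinearRealization (L : Multiset ℕ) : Prop :=
  ∃ l : List ℕ, IsLinearRealization L l ∧ l.head? = some 0 ∧
    l.getLast? = some (Multiset.card L)

/-- The multiset of cyclic edge-lengths `min(|gᵢ₊₁ - gᵢ|, v - |gᵢ₊₁ - gᵢ|)`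
of consecutive entries of a list of naturals. -/
def cycDiffs (v : ℕ) (l : List ℕ) : Multiset ℕ :=
  ↑(List.zipWith (fun a b => min ((a - b) + (b - a)) (v - ((a - b) + (b - a)))) l l.tail)

/-- `L` is (cyclically) realizable in `K_v`: some Hamiltonian path on the vertex
set `{0, …, v-1}` has `L` as its multiset of edge-lengths. -/
def IsRealizable (v : ℕ) (L : Multiset ℕ) : Prop :=
  ∃ l : List ℕ, l.Perm (List.range v) ∧ cycDiffs v l = L

/-- The multiset `{1^a, x^b, y^c}`. -/
def mset3 (a b c x y : ℕ) : Multiset ℕ :=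
  Multiset.replicate a 1 + Multiset.replicate b x + Multiset.replicate c y

/-- With `b = q'x + r'`, `0 ≤ r' < x`: `ω(x,b) = x - 1` if `q' = 0`, `r' = 1`,
or at least one of `x`, `r'` is even; otherwise `ω(x,b) = x`. -/
def omegaBHR (x b : ℕ) : ℕ :=
  if b / x = 0 ∨ b % x = 1 ∨ Even x ∨ Even (b % x) then x - 1 else x

/-- The reduced form `ĝ = min(g, v - g)`. -/
def reducedForm (v g : ℕ) : ℕ := min g (v - g)

/-- The function `f` of Theorem 3.7 (counterexample characterization refined). -/
def fBHR (u w : ℕ) : ℕ :=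
  if Even u ∧ Even w then w - 1
  else if u = 3 ∨ (Even u ∧ ¬ Even w) then u + w - 2
  else u + w - 1

/-- A multiset `L` of size `v - 1` with elements in `{1, …, ⌊v/2⌋}` is admissible
if for every divisor `d` of `v` the number of elements of `L` divisible by `d`
is at most `v - d`. -/
def IsAdmissible (v : ℕ) (L : Multiset ℕ) : Prop :=
  Multiset.card L = v - 1 ∧ (∀ z ∈ L, 1 ≤ z ∧ z ≤ v / 2) ∧
  ∀ d : ℕ, d ∣ v → Multiset.card (L.filter (fun z => d ∣ z)) ≤ v - d

/-! ### Difference multisets of lists -/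

theorem mset3_add (a b c a' b' c' x y : ℕ) :
    mset3 a b c x y + mset3 a' b' c' x y = mset3 (a + a') (b + b') (c + c') x y := by
  simp only [mset3, Multiset.replicate_add]
  abel

theorem singleton_one_eq_mset3 (x y : ℕ) : ({1} : Multiset ℕ) = mset3 1 0 0 x y := by
  simp [mset3]

theorem singleton_x_eq_mset3 (x y : ℕ) : ({x} : Multiset ℕ) = mset3 0 1 0 x y := by
  simp [mset3]

theorem singleton_y_eq_mset3 (x y : ℕ) : ({y} : Multiset ℕ) = mset3 0 0 1 x y := by
  simp [mset3]

theorem card_mset3 (a b c x y : ℕ) : (mset3 a b c x y).card = a + b + c := by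
  simp [mset3]

@[simp]
theorem linDiffs_singleton (a : ℕ) : linDiffs [a] = 0 := rfl

theorem linDiffs_cons_cons (a b : ℕ) (t : List ℕ) :
    linDiffs (a :: b :: t) = {(a - b) + (b - a)} + linDiffs (b :: t) := rfl

theorem linDiffs_append_cons (s : List ℕ) (a : ℕ) (t : List ℕ) :
    linDiffs (s ++ a :: t) = linDiffs (s ++ [a]) + linDiffs (a :: t) := by
  induction s with
  | nil => simp
  | cons b s ih =>
    cases s with
    | nil => simp [linDiffs_cons_cons]
    | cons c s =>
      simp only [List.cons_append, linDiffs_cons_cons] at ih ⊢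
      rw [ih, add_assoc]

theorem linDiffs_append {l₁ l₂ : List ℕ} {p q : ℕ} (h₁ : l₁.getLast? = some p)
    (h₂ : l₂.head? = some q) :
    linDiffs (l₁ ++ l₂) = linDiffs l₁ + {(p - q) + (q - p)} + linDiffs l₂ := by
  obtain ⟨s, rfl⟩ := List.getLast?_eq_some_iff.1 h₁
  obtain ⟨t, rfl⟩ := List.head?_eq_some_iff.1 h₂
  rw [List.append_assoc, List.singleton_append, linDiffs_append_cons, linDiffs_cons_cons, add_assoc]

theorem linDiffs_reverse (l : List ℕ) : linDiffs l.reverse = linDiffs l := by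
  induction l with
  | nil => rfl
  | cons a l ih =>
    cases l with
    | nil => rfl
    | cons b l =>
      rw [List.reverse_cons, List.reverse_cons, List.append_assoc, List.singleton_append,
        linDiffs_append_cons, ← List.reverse_cons, ih, linDiffs_cons_cons, linDiffs_cons_cons,
        linDiffs_singleton, add_zero, add_comm, add_comm (a - b)]

theorem linDiffs_map_of_dist {f : ℕ → ℕ} {l : List ℕ}
    (h : ∀ a ∈ l, ∀ b ∈ l, (f a - f b) + (f b - f a) = (a - b) + (b - a)) :
    linDiffs (l.map f) = linDiffs l := by
  induction l with
  | nil => rfl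
  | cons a l ih =>
    cases l with
    | nil => rfl
    | cons b l =>
      simp only [List.map_cons, linDiffs_cons_cons] at ih ⊢
      rw [ih fun p hp q hq => h p (List.mem_cons_of_mem _ hp) q (List.mem_cons_of_mem _ hq),
        h a (by simp) b (by simp)]

theorem linDiffs_map_add (k : ℕ) (l : List ℕ) : linDiffs (l.map (k + ·)) = linDiffs l :=
  linDiffs_map_of_dist fun _ _ _ _ => by omega

theorem linDiffs_map_sub {k : ℕ} {l : List ℕ} (h : ∀ a ∈ l, a ≤ k) :
    linDiffs (l.map (k - ·)) = linDiffs l :=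
  linDiffs_map_of_dist fun a ha b hb => by have := h a ha; have := h b hb; omega

theorem card_linDiffs (l : List ℕ) : (linDiffs l).card = l.length - 1 := by
  simp [linDiffs]

theorem linDiffs_range' (s k : ℕ) : linDiffs (List.range' s (k + 1)) = Multiset.replicate k 1 := by
  induction k generalizing s with
  | zero => rfl
  | succ k ih =>
    have := ih (s + 1)
    rw [List.range'_succ] at this
    rw [List.range'_succ, List.range'_succ, linDiffs_cons_cons, this, Multiset.replicate_succ,
      Multiset.singleton_add]
    congr 1
    omega

theorem map_sub_range (m : ℕ) :
    (Multiset.range m).map (m - 1 - ·) = Multiset.range m := by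
  have h := List.reverse_range' (s := 0) (n := m)
  rw [Multiset.range, Multiset.map_coe, Multiset.coe_eq_coe]
  simp only [zero_add] at h
  rw [← h, ← List.range_eq_range']
  exact List.reverse_perm _

/-! ### Adjacent entries -/

/-- `p` and `q` occupy neighbouring positions of the list, in either order. -/
def Adjacent (p q : ℕ) : List ℕ → Prop
  | a :: b :: t => (a = p ∧ b = q) ∨ (a = q ∧ b = p) ∨ Adjacent p q (b :: t)
  | _ => False

theorem Adjacent.exists_split {p q : ℕ} {l : List ℕ} (h : Adjacent p q l) :
    ∃ s u v t, l = s ++ u :: v :: t ∧ ((u = p ∧ v = q) ∨ (u = q ∧ v = p)) := by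
  induction l with
  | nil => exact h.elim
  | cons a l ih =>
    cases l with
    | nil => exact h.elim
    | cons b l =>
      rcases h with h | h | h
      · exact ⟨[], a, b, l, rfl, Or.inl h⟩
      · exact ⟨[], a, b, l, rfl, Or.inr h⟩
      · obtain ⟨s, u, v, t, hs, huv⟩ := ih h
        exact ⟨a :: s, u, v, t, by rw [hs]; rfl, huv⟩

theorem adjacent_append_cons {p q : ℕ} (s : List ℕ) (a : ℕ) (t : List ℕ) :
    Adjacent p q (s ++ a :: t) ↔ Adjacent p q (s ++ [a]) ∨ Adjacent p q (a :: t) := by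
  induction s with
  | nil => simp [Adjacent]
  | cons b s ih =>
    cases s with
    | nil => simp [Adjacent, or_assoc]
    | cons c s =>
      simp only [List.cons_append, Adjacent] at ih ⊢
      rw [ih, or_assoc, or_assoc]

theorem Adjacent.append_left {p q : ℕ} {l : List ℕ} (h : Adjacent p q l) (s : List ℕ) :
    Adjacent p q (s ++ l) := by
  cases l with
  | nil => exact h.elim
  | cons a l => exact (adjacent_append_cons s a l).2 (Or.inr h)

theorem Adjacent.append_right {p q : ℕ} {l : List ℕ} (h : Adjacent p q l) (t : List ℕ) :
    Adjacent p q (l ++ t) := by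
  obtain ⟨s, u, v, t', rfl, huv⟩ := h.exists_split
  rw [List.append_assoc]
  refine Adjacent.append_left ?_ s
  rcases huv with ⟨rfl, rfl⟩ | ⟨rfl, rfl⟩ <;> simp [Adjacent]

theorem Adjacent.mem {p q : ℕ} {l : List ℕ} (h : Adjacent p q l) : p ∈ l ∧ q ∈ l := by
  obtain ⟨s, u, v, t, rfl, ⟨rfl, rfl⟩ | ⟨rfl, rfl⟩⟩ := h.exists_split <;> simp

theorem Adjacent.reverse {p q : ℕ} {l : List ℕ} (h : Adjacent p q l) :
    Adjacent p q l.reverse := by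
  obtain ⟨s, u, v, t, rfl, huv⟩ := h.exists_split
  have : (s ++ u :: v :: t).reverse = t.reverse ++ (v :: u :: s.reverse) := by simp
  rw [this]
  refine Adjacent.append_left ?_ _
  rcases huv with ⟨rfl, rfl⟩ | ⟨rfl, rfl⟩ <;> simp [Adjacent]

theorem adjacent_range' {s k u : ℕ} (h₁ : s ≤ u) (h₂ : u + 1 < s + k) :
    Adjacent u (u + 1) (List.range' s k) := by
  induction k generalizing s with
  | zero => omega
  | succ k ih =>
    cases k with
    | zero => omega
    | succ k =>
      rcases h₁.eq_or_lt with rfl | h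
      · simp [List.range'_succ, Adjacent]
      · have := ih (s := s + 1) h (by omega)
        rw [List.range'_succ]
        exact this.append_left [s]

/-- Inserting entries between neighbours `u` and `v` keeps every other pair of neighbours. -/
theorem Adjacent.insert {p q u v : ℕ} {s t : List ℕ} (h : Adjacent p q (s ++ u :: v :: t))
    (hne : ¬ ((u = p ∧ v = q) ∨ (u = q ∧ v = p))) (m : List ℕ) :
    Adjacent p q (s ++ u :: (m ++ v :: t)) := by
  rw [adjacent_append_cons] at h
  rcases h with h | h | h | h
  · exact (adjacent_append_cons _ _ _).2 (Or.inl h)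
  · exact absurd (Or.inl h) hne
  · exact absurd (Or.inr h) hne
  · exact Adjacent.append_left (Adjacent.append_left (l := v :: t) h (u :: m)) s

theorem exists_eq_cons_of_adjacent {p q r : ℕ} {s t : List ℕ} (hl : (s ++ p :: q :: t).Nodup)
    (hpr : p ≠ r) (h : Adjacent q r (s ++ p :: q :: t)) : ∃ t', t = r :: t' := by
  have hs : q ∉ s ∧ p ≠ q ∧ q ∉ t := by
    simp only [List.nodup_append, List.nodup_cons, List.mem_cons] at hl
    exact ⟨fun hq => hl.2.2 q hq q (Or.inr (Or.inl rfl)) rfl,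
      fun hq => hl.2.1.1 (Or.inl hq), hl.2.1.2.1⟩
  rw [adjacent_append_cons] at h
  rcases h with h | h | h | h
  · have := h.mem.1
    simp only [List.mem_append, List.mem_singleton] at this
    exact absurd this (by simp [hs.1, hs.2.1.symm])
  · exact absurd h.1 hs.2.1
  · exact absurd h.1 hpr
  · cases t with
    | nil => exact h.elim
    | cons c t =>
      rcases h with h | h | h
      · exact ⟨t, by rw [h.2]⟩
      · exact absurd h.2 fun hc => hs.2.2 (by simp [hc])
      · exact absurd h.mem.1 hs.2.2

theorem exists_split_of_adjacent {p q r : ℕ} {l : List ℕ} (hl : l.Nodup) (hpr : p ≠ r)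
    (h₁ : Adjacent p q l) (h₂ : Adjacent q r l) :
    ∃ s u v t, l = s ++ u :: q :: v :: t ∧ ((u = p ∧ v = r) ∨ (u = r ∧ v = p)) := by
  obtain ⟨s, u, v, t, rfl, ⟨rfl, rfl⟩ | ⟨rfl, rfl⟩⟩ := h₁.exists_split
  · obtain ⟨t', rfl⟩ := exists_eq_cons_of_adjacent hl hpr h₂
    exact ⟨s, u, r, t', rfl, Or.inl ⟨rfl, rfl⟩⟩
  · have hrev : (s ++ u :: v :: t).reverse = t.reverse ++ v :: u :: s.reverse := by simp
    have h₂' := h₂.reverse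
    have hl' := List.nodup_reverse.2 hl
    rw [hrev] at h₂' hl'
    obtain ⟨t', ht'⟩ := exists_eq_cons_of_adjacent hl' hpr h₂'
    refine ⟨t'.reverse, r, v, t, ?_, Or.inr ⟨rfl, rfl⟩⟩
    rw [List.reverse_eq_iff] at ht'
    simp [ht']

/-! ### Realizations of `{1^a, x^b}` grown from the right -/

theorem exists_insert_pair {x n u : ℕ} {l : List ℕ} (hl : (l : Multiset ℕ) = Multiset.range n)
    (hu : u + x = n) (hadj : Adjacent u (u + 1) l) :
    ∃ l' : List ℕ, (l' : Multiset ℕ) = Multiset.range (n + 2) ∧ l'.head? = l.head? ∧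
      l'.getLast? = l.getLast? ∧ linDiffs l' = linDiffs l + {x} + {x} ∧ Adjacent n (n + 1) l' ∧
      ∀ p, p ≠ u → Adjacent p (p + 1) l → Adjacent p (p + 1) l' := by
  obtain ⟨s, w, v, t, rfl, hwv⟩ := hadj.exists_split
  refine ⟨s ++ w :: ([w + x, v + x] ++ v :: t), ?_, ?_, ?_, ?_, ?_, fun p hp h => h.insert ?_ _⟩
  · have h₁ : ({w + x, v + x} : Multiset ℕ) = {n, n + 1} := by
      rcases hwv with ⟨rfl, rfl⟩ | ⟨rfl, rfl⟩
      · rw [hu, add_right_comm, hu]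
      · rw [hu, add_right_comm, hu, Multiset.pair_comm]
    have h₂ : ((s ++ w :: ([w + x, v + x] ++ v :: t) : List ℕ) : Multiset ℕ) =
        ((s ++ w :: v :: t : List ℕ) : Multiset ℕ) + {w + x, v + x} := by
      simp only [List.cons_append, List.nil_append, ← Multiset.coe_add, ← Multiset.cons_coe]
      simp only [Multiset.insert_eq_cons, ← Multiset.singleton_add]
      abel
    rw [h₂, h₁, hl, Multiset.range_succ, Multiset.range_succ]
    simp only [Multiset.insert_eq_cons, ← Multiset.singleton_add]
    abel
  · cases s <;> simp
  · simp [List.getLast?_append, List.getLast?_cons]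
  · rw [linDiffs_append_cons, linDiffs_append_cons s w (v :: t)]
    simp only [List.cons_append, List.nil_append, linDiffs_cons_cons]
    have h₁ : w - (w + x) + (w + x - w) = x := by omega
    have h₂ : v + x - v + (v - (v + x)) = x := by omega
    have h₃ : w + x - (v + x) + (v + x - (w + x)) = w - v + (v - w) := by omega
    rw [h₁, h₂, h₃]
    abel
  · refine Adjacent.append_left (Adjacent.append_right (l := [w, w + x, v + x]) ?_ (v :: t)) s
    simp only [Adjacent]
    omega
  · omega

/-- A path on `0, …, a + b` with differences `{1^a, x^b}` from `0` to `e` that can be extended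
to the right: either `e + x` is the next value, or the pairs next to `e` among the last `x`
values are traversed consecutively. -/
structure IsGrowing (x y a b e : ℕ) (l : List ℕ) : Prop where
  coe_eq : (l : Multiset ℕ) = Multiset.range (a + b + 1)
  head : l.head? = some 0
  last : l.getLast? = some e
  diffs : linDiffs l = mset3 a b 0 x y
  le : x ≤ a + b + 1
  lt : e < a + b + 1
  window : a + b + 1 ≤ e + x
  parity : (e + x) % 2 = (a + b + 1) % 2
  adj : ∀ u, a + b + 1 ≤ u + x → u + 1 < a + b + 1 →
    ((u < e ∧ u % 2 = e % 2) ∨ (e < u ∧ u % 2 ≠ e % 2)) → Adjacent u (u + 1) l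

theorem IsGrowing.insert {x y a b e : ℕ} {l : List ℕ} (hx : Odd x) (h : IsGrowing x y a b e l)
    (he : a + b + 1 < e + x) : ∃ l', IsGrowing x y a (b + 2) e l' := by
  have hle := h.le
  have hlt := h.lt
  have hp := h.parity
  obtain ⟨k, rfl⟩ := hx
  obtain ⟨u, hu⟩ : ∃ u, u + (2 * k + 1) = a + b + 1 := ⟨a + b + 1 - (2 * k + 1), by omega⟩
  obtain ⟨l', h₁, h₂, h₃, h₄, h₅, h₆⟩ := exists_insert_pair h.coe_eq hu
    (h.adj u (by omega) (by omega) (by omega))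
  refine ⟨l', h₁.trans (by congr 1), h₂.trans h.head, h₃.trans h.last, ?_, by omega, by omega,
    by omega, by omega, fun p hp₁ hp₂ hp₃ => ?_⟩
  · rw [h₄, h.diffs, singleton_x_eq_mset3 _ y, mset3_add, mset3_add]
    rfl
  · rcases eq_or_ne p (a + b + 1) with rfl | hne
    · exact h₅
    · exact h₆ p (by omega) (h.adj p (by omega) (by omega) hp₃)

theorem IsGrowing.append {x y a b e : ℕ} {l : List ℕ} (hx : Odd x) (h : IsGrowing x y a b e l)
    (he : e + x = a + b + 1) : IsGrowing x y a (b + 1) (a + b + 1) (l ++ [a + b + 1]) := by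
  have hle := h.le
  obtain ⟨k, rfl⟩ := hx
  refine ⟨?_, ?_, by simp, ?_, by omega, by omega, by omega, by omega, fun u hu₁ hu₂ hu₃ => ?_⟩
  · rw [← Multiset.coe_add, h.coe_eq, ← add_assoc a b 1, Multiset.range_succ (a + b + 1), add_comm,
      Multiset.coe_singleton, Multiset.singleton_add]
  · simp [h.head]
  · rw [linDiffs_append h.last (q := a + b + 1) (by simp), h.diffs, linDiffs_singleton, add_zero]
    have : e - (a + b + 1) + (a + b + 1 - e) = 2 * k + 1 := by omega
    rw [this, singleton_x_eq_mset3 _ y, mset3_add]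
    rfl
  · exact (h.adj u (by omega) (by omega) (by omega)).append_right _

theorem IsGrowing.insert_pairs {x y a b e : ℕ} {l : List ℕ} (hx : Odd x)
    (h : IsGrowing x y a b e l) (j : ℕ) (hj : a + b + 2 * j + 1 ≤ e + x) :
    ∃ l', IsGrowing x y a (b + 2 * j) e l' := by
  induction j with
  | zero => exact ⟨l, h⟩
  | succ j ih =>
    obtain ⟨l', h'⟩ := ih (by omega)
    have h'' := h'.insert hx (by omega)
    rwa [add_assoc, ← mul_add_one 2 j] at h''

theorem IsGrowing.cycles {x y a b : ℕ} {l : List ℕ} (hx : Odd x)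
    (h : IsGrowing x y a b (a + b) l) (m : ℕ) :
    ∃ l', IsGrowing x y a (b + m * x) (a + b + m * x) l' := by
  induction m with
  | zero => simpa using ⟨l, h⟩
  | succ m ih =>
    obtain ⟨l₁, h₁⟩ := ih
    obtain ⟨k, rfl⟩ := hx
    obtain ⟨l₂, h₂⟩ := h₁.insert_pairs ⟨k, rfl⟩ k (by omega)
    have h₃ := h₂.append ⟨k, rfl⟩ (by omega)
    have e₁ : b + m * (2 * k + 1) + 2 * k + 1 = b + (m + 1) * (2 * k + 1) := by ring
    have e₂ : a + (b + m * (2 * k + 1) + 2 * k) + 1 = a + b + (m + 1) * (2 * k + 1) := by ring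
    rw [e₁, e₂] at h₃
    exact ⟨_, h₃⟩

theorem isGrowing_range {x y a : ℕ} (hx : Odd x) (ha : x ≤ a + 1) :
    IsGrowing x y a 0 a (List.range' 0 (a + 1)) := by
  obtain ⟨k, rfl⟩ := hx
  refine ⟨?_, ?_, ?_, ?_, by omega, by omega, by omega, by omega, fun u _ _ _ => ?_⟩
  · rw [← List.range_eq_range', Multiset.coe_range]
  · simp [List.range'_succ]
  · simp [List.range'_concat]
  · rw [linDiffs_range']; simp [mset3]
  · exact adjacent_range' (by omega) (by omega)

theorem isGrowing_range_append_reverse {x y t : ℕ} (hx : Odd x) :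
    IsGrowing x y (t + x - 1) 1 (t + 1)
      (List.range' 0 (t + 1) ++ (List.range' (t + 1) x).reverse) := by
  obtain ⟨k, rfl⟩ := hx
  refine ⟨?_, ?_, ?_, ?_, by omega, by omega, by omega, by omega, fun u _ _ _ => ?_⟩
  · rw [← Multiset.coe_add, Multiset.coe_reverse, Multiset.coe_add]
    have := List.range'_append (s := 0) (m := t + 1) (n := 2 * k + 1) (step := 1)
    simp only [zero_add, one_mul] at this
    rw [this, ← List.range_eq_range', Multiset.coe_range]
    congr 1; omega
  · simp [List.range'_succ]
  · simp [List.range'_succ, List.getLast?_cons]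
  · rw [linDiffs_append (p := t) (q := t + 1 + 2 * k) (by simp [List.range'_concat])
      (by simp [List.range'_concat]), linDiffs_reverse, linDiffs_range', linDiffs_range']
    have : t - (t + 1 + 2 * k) + (t + 1 + 2 * k - t) = 2 * k + 1 := by omega
    have h : t + (2 * k + 1) - 1 = t + 2 * k := by omega
    rw [this, h]
    simp only [mset3, Multiset.replicate_add]
    simp
    abel
  · exact (adjacent_range' (by omega) (by omega)).reverse.append_left _

/-- A path on `0, …, a + b` with differences `{1^a, x^b}` from `0` to `e`, traversing
`k, k + 1, k + 2` consecutively with `e + x = k + 1`, and traversing every second pair of the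
other values in the last `x` places consecutively. -/
structure IsTurning (x y a b k e : ℕ) (l : List ℕ) : Prop where
  coe_eq : (l : Multiset ℕ) = Multiset.range (a + b + 1)
  head : l.head? = some 0
  last : l.getLast? = some e
  diffs : linDiffs l = mset3 a b 0 x y
  turn : e + x = k + 1
  le : k + 3 ≤ a + b + 1
  parity : (a + b + 1) % 2 ≠ k % 2
  adj₁ : Adjacent k (k + 1) l
  adj₂ : Adjacent (k + 1) (k + 2) l
  low : ∀ u, a + b + 1 ≤ u + x → u + 2 ≤ k → u % 2 = k % 2 → Adjacent u (u + 1) l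
  high : ∀ u, k + 3 ≤ u → u + 2 ≤ a + b + 1 → u % 2 ≠ k % 2 → Adjacent u (u + 1) l

theorem IsTurning.insert {x y a b k e : ℕ} {l : List ℕ} (hx : Odd x)
    (h : IsTurning x y a b k e l) (hk : a + b + 1 + 2 ≤ k + x) :
    ∃ l', IsTurning x y a (b + 2) k e l' := by
  have hle := h.le
  have ht := h.turn
  have hp := h.parity
  obtain ⟨i, rfl⟩ := hx
  obtain ⟨u, hu⟩ : ∃ u, u + (2 * i + 1) = a + b + 1 := ⟨a + b + 1 - (2 * i + 1), by omega⟩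
  obtain ⟨l', h₁, h₂, h₃, h₄, h₅, h₆⟩ := exists_insert_pair h.coe_eq hu
    (h.low u (by omega) (by omega) (by omega))
  refine ⟨l', h₁.trans (by congr 1), h₂.trans h.head, h₃.trans h.last, ?_, ht, by omega,
    by omega, h₆ k (by omega) h.adj₁, h₆ (k + 1) (by omega) h.adj₂,
    fun p hp₁ hp₂ hp₃ => h₆ p (by omega) (h.low p (by omega) hp₂ hp₃),
    fun p hp₁ hp₂ hp₃ => ?_⟩
  · rw [h₄, h.diffs, singleton_x_eq_mset3 _ y, mset3_add, mset3_add]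
    rfl
  · rcases eq_or_ne p (a + b + 1) with rfl | hne
    · exact h₅
    · exact h₆ p (by omega) (h.high p (by omega) (by omega) hp₃)

theorem IsTurning.insert_pairs {x y a b k e : ℕ} {l : List ℕ} (hx : Odd x)
    (h : IsTurning x y a b k e l) (j : ℕ) (hj : a + b + 2 * j + 1 ≤ k + x) :
    ∃ l', IsTurning x y a (b + 2 * j) k e l' := by
  induction j with
  | zero => exact ⟨l, h⟩
  | succ j ih =>
    obtain ⟨l', h'⟩ := ih (by omega)
    have h'' := h'.insert hx (by omega)
    rwa [add_assoc, ← mul_add_one 2 j] at h''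

theorem IsTurning.turn_around {x y a b k e : ℕ} {l : List ℕ} (hx : Odd x)
    (h : IsTurning x y a b k e l) (hk : a + b + 1 = k + x) :
    ∃ l', IsTurning x y a (b + 3) (k + x) (k + 1) l' := by
  have ht := h.turn
  have hle := h.le
  have hnodup : l.Nodup := by
    rw [← Multiset.coe_nodup, h.coe_eq]
    exact Multiset.nodup_range _
  obtain ⟨s, u, v, t, rfl, huv⟩ := exists_split_of_adjacent hnodup (by omega) h.adj₁ h.adj₂
  obtain ⟨i, rfl⟩ := hx
  have hlast : (v :: t).getLast? = some e := by
    have := h.last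
    rwa [show s ++ u :: (k + 1) :: v :: t = (s ++ [u, k + 1]) ++ v :: t by simp,
      List.getLast?_append_cons] at this
  have keep : ∀ p, k + 3 ≤ p → Adjacent p (p + 1) (s ++ u :: (k + 1) :: v :: t) →
      Adjacent p (p + 1) (s ++ u :: (u + (2 * i + 1)) :: (k + 1 + (2 * i + 1)) ::
        (v + (2 * i + 1)) :: (v :: t ++ [k + 1])) := by
    intro p hp hadj
    rw [adjacent_append_cons] at hadj ⊢
    refine hadj.imp_right ?_
    rintro (h' | h' | h' | h' | h')
    · omega
    · omega
    · omega
    · omega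
    · exact Adjacent.append_left (h'.append_right [k + 1])
        [u, u + (2 * i + 1), k + 1 + (2 * i + 1), v + (2 * i + 1)]
  have new : ∀ p, (k + (2 * i + 1) ≤ p ∧ p < k + (2 * i + 1) + 2) →
      Adjacent p (p + 1) (s ++ u :: (u + (2 * i + 1)) :: (k + 1 + (2 * i + 1)) ::
        (v + (2 * i + 1)) :: (v :: t ++ [k + 1])) := by
    intro p hp
    refine Adjacent.append_left (l := u :: (u + (2 * i + 1)) :: (k + 1 + (2 * i + 1)) ::
        (v + (2 * i + 1)) :: (v :: t ++ [k + 1])) ?_ s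
    have : ((u + (2 * i + 1) = p ∧ k + 1 + (2 * i + 1) = p + 1) ∨
        (u + (2 * i + 1) = p + 1 ∧ k + 1 + (2 * i + 1) = p)) ∨
        ((k + 1 + (2 * i + 1) = p ∧ v + (2 * i + 1) = p + 1) ∨
        (k + 1 + (2 * i + 1) = p + 1 ∧ v + (2 * i + 1) = p)) := by omega
    simp only [Adjacent]
    tauto
  refine ⟨s ++ u :: (u + (2 * i + 1)) :: (k + 1 + (2 * i + 1)) :: (v + (2 * i + 1)) ::
    (v :: t ++ [k + 1]), ?_, ?_, ?_, ?_, by omega, by omega, by omega, new _ (by omega),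
    new _ (by omega), fun p hp₁ hp₂ hp₃ => keep p (by omega) (h.high p (by omega) (by omega)
    (by omega)), fun p hp₁ hp₂ hp₃ => by omega⟩
  · have h₁ : ({u + (2 * i + 1), v + (2 * i + 1)} : Multiset ℕ) =
        {k + (2 * i + 1), k + 2 + (2 * i + 1)} := by
      rcases huv with ⟨rfl, rfl⟩ | ⟨rfl, rfl⟩
      · rfl
      · rw [Multiset.pair_comm]
    have h₂ : ((s ++ u :: (u + (2 * i + 1)) :: (k + 1 + (2 * i + 1)) :: (v + (2 * i + 1)) ::
        (v :: t ++ [k + 1]) : List ℕ) : Multiset ℕ) =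
        ((s ++ u :: (k + 1) :: v :: t : List ℕ) : Multiset ℕ) +
          {u + (2 * i + 1), v + (2 * i + 1)} + {k + 1 + (2 * i + 1)} := by
      simp only [List.cons_append, ← Multiset.coe_add, ← Multiset.cons_coe]
      simp only [Multiset.insert_eq_cons, ← Multiset.singleton_add, Multiset.coe_nil]
      abel
    have h₃ : k + 1 + (2 * i + 1) = k + (2 * i + 1) + 1 := by omega
    have h₄ : k + 2 + (2 * i + 1) = k + (2 * i + 1) + 1 + 1 := by omega
    rw [h₂, h₁, h.coe_eq, hk, show a + (b + 3) + 1 = k + (2 * i + 1) + 1 + 1 + 1 by omega,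
      Multiset.range_succ, Multiset.range_succ, Multiset.range_succ, h₃, h₄]
    simp only [Multiset.insert_eq_cons, ← Multiset.singleton_add]
    abel
  · have := h.head
    cases s <;> simpa using this
  · simp [List.getLast?_append, List.getLast?_cons]
  · have hd := h.diffs
    rw [linDiffs_append_cons] at hd ⊢
    simp only [linDiffs_cons_cons] at hd ⊢
    have hvt : linDiffs (v :: (t ++ [k + 1])) = linDiffs (v :: t) + {2 * i + 1} := by
      rw [← List.cons_append, linDiffs_append hlast (q := k + 1) (by simp), linDiffs_singleton,
        add_zero]
      congr 2
      omega
    have e₁ : u - (k + 1) + (k + 1 - u) = 1 := by omega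
    have e₂ : k + 1 - v + (v - (k + 1)) = 1 := by omega
    have e₃ : u - (u + (2 * i + 1)) + (u + (2 * i + 1) - u) = 2 * i + 1 := by omega
    have e₄ : u + (2 * i + 1) - (k + 1 + (2 * i + 1)) +
      (k + 1 + (2 * i + 1) - (u + (2 * i + 1))) = 1 := by omega
    have e₅ : k + 1 + (2 * i + 1) - (v + (2 * i + 1)) +
      (v + (2 * i + 1) - (k + 1 + (2 * i + 1))) = 1 := by omega
    have e₆ : v + (2 * i + 1) - v + (v - (v + (2 * i + 1))) = 2 * i + 1 := by omega
    rw [e₁, e₂] at hd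
    rw [List.cons_append, linDiffs_cons_cons, e₃, e₄, e₅, e₆, hvt]
    calc _ = (linDiffs (s ++ [u]) + ({1} + ({1} + linDiffs (v :: t)))) +
          ({2 * i + 1} + {2 * i + 1} + {2 * i + 1}) := by abel
      _ = _ := by
        rw [hd, singleton_x_eq_mset3 _ y, mset3_add, mset3_add, mset3_add]
        rfl

theorem isTurning_base {x y t : ℕ} (hx : Odd x) (hx3 : 3 ≤ x) :
    IsTurning x y (t + x) 3 (t + x + 1) (t + 2)
      (List.range' 0 (t + 1) ++ ((List.range' (t + 3) (x - 2)).reverse ++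
        [t + x + 3, t + x + 2, t + x + 1, t + 1, t + 2])) := by
  obtain ⟨i, rfl⟩ : ∃ i, x = 2 * i + 3 := by
    obtain ⟨k, rfl⟩ := hx
    exact ⟨k - 1, by omega⟩
  rw [show 2 * i + 3 - 2 = 2 * i + 1 by omega]
  refine ⟨?_, ?_, ?_, ?_, by omega, by omega, by omega, ?_, ?_, fun u h₁ h₂ _ => ?_,
    fun u h₁ h₂ _ => by omega⟩
  · have h := List.range'_append (s := t + 3) (m := 2 * i + 1) (n := 3) (step := 1)
    have h' := List.range'_append (s := 0) (m := t + 1) (n := 2 + (2 * i + 1 + 3)) (step := 1)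
    have h'' := List.range'_append (s := t + 1) (m := 2) (n := 2 * i + 1 + 3) (step := 1)
    simp only [zero_add, one_mul] at h h' h''
    rw [show t + (2 * i + 3) + 3 + 1 = t + 1 + (2 + (2 * i + 1 + 3)) by omega,
      ← Multiset.coe_range, List.range_eq_range', ← h', ← h'', show t + 1 + 2 = t + 3 by rfl, ← h]
    have h₂ : (List.range' (t + 1) 2 : Multiset ℕ) = {t + 1} + {t + 2} := rfl
    have h₃ : (List.range' (t + 3 + (2 * i + 1)) 3 : Multiset ℕ) =
        {t + (2 * i + 3) + 1} + {t + (2 * i + 3) + 2} + {t + (2 * i + 3) + 3} := by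
      rw [show t + 3 + (2 * i + 1) = t + (2 * i + 3) + 1 by omega]
      rfl
    have h₄ : (([t + (2 * i + 3) + 3, t + (2 * i + 3) + 2, t + (2 * i + 3) + 1, t + 1, t + 2] :
        List ℕ) : Multiset ℕ) = {t + (2 * i + 3) + 3} + {t + (2 * i + 3) + 2} +
        {t + (2 * i + 3) + 1} + {t + 1} + {t + 2} := rfl
    simp only [← Multiset.coe_add, Multiset.coe_reverse]
    rw [h₂, h₃, h₄]
    abel
  · simp [List.range'_succ]
  · simp [List.getLast?_append]
  · rw [linDiffs_append (p := t) (q := t + 3 + 2 * i) (by simp [List.range'_concat])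
      (by simp [List.range'_concat]), linDiffs_append (p := t + 3) (q := t + (2 * i + 3) + 3)
      (by simp [List.range'_succ]) (by simp), linDiffs_reverse, linDiffs_range', linDiffs_range']
    simp only [linDiffs_cons_cons, linDiffs_singleton]
    have e₁ : t - (t + 3 + 2 * i) + (t + 3 + 2 * i - t) = 2 * i + 3 := by omega
    have e₂ : t + 3 - (t + (2 * i + 3) + 3) + (t + (2 * i + 3) + 3 - (t + 3)) = 2 * i + 3 := by
      omega
    have e₃ : t + (2 * i + 3) + 3 - (t + (2 * i + 3) + 2) +
      (t + (2 * i + 3) + 2 - (t + (2 * i + 3) + 3)) = 1 := by omega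
    have e₄ : t + (2 * i + 3) + 2 - (t + (2 * i + 3) + 1) +
      (t + (2 * i + 3) + 1 - (t + (2 * i + 3) + 2)) = 1 := by omega
    have e₅ : t + (2 * i + 3) + 1 - (t + 1) + (t + 1 - (t + (2 * i + 3) + 1)) = 2 * i + 3 := by
      omega
    have e₆ : t + 1 - (t + 2) + (t + 2 - (t + 1)) = 1 := by omega
    rw [e₁, e₂, e₃, e₄, e₅, e₆]
    simp only [mset3, Multiset.replicate_add, Multiset.replicate_succ, Multiset.replicate_zero,
      ← Multiset.singleton_add]
    abel
  · refine Adjacent.append_left (Adjacent.append_left ?_ _) _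
    simp [Adjacent]
  · refine Adjacent.append_left (Adjacent.append_left ?_ _) _
    simp [Adjacent]
  · exact ((adjacent_range' (by omega) (by omega)).reverse.append_right _).append_left _

theorem exists_isTurning {x y t : ℕ} (hx : Odd x) (hx3 : 3 ≤ x) (m : ℕ) :
    ∃ k e l, IsTurning x y (t + x) (3 + m * x) k e l ∧ k + 3 = t + x + (3 + m * x) + 1 := by
  induction m with
  | zero => exact ⟨_, _, _, by simpa using isTurning_base hx hx3, by omega⟩
  | succ m ih =>
    obtain ⟨k, e, l, h, hk⟩ := ih
    obtain ⟨i, rfl⟩ : ∃ i, x = 2 * i + 3 := by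
      obtain ⟨k, rfl⟩ := hx
      exact ⟨k - 1, by omega⟩
    obtain ⟨l₁, h₁⟩ := h.insert_pairs hx i (by omega)
    obtain ⟨l₂, h₂⟩ := h₁.turn_around hx (by omega)
    have e₁ : 3 + m * (2 * i + 3) + 2 * i + 3 = 3 + (m + 1) * (2 * i + 3) := by ring
    rw [e₁] at h₂
    exact ⟨_, _, _, h₂, by rw [← e₁]; omega⟩

/-- The multiset `{1^a, x^b}` has a standard linear realization. -/
theorem exists_standard {x y a b : ℕ} (hx : Odd x) (hx3 : 3 ≤ x)
    (h : x ≤ a ∨ (x = 3 ∧ 2 ≤ a) ∨ b = 0) :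
    ∃ l : List ℕ, (l : Multiset ℕ) = Multiset.range (a + b + 1) ∧ l.head? = some 0 ∧
      linDiffs l = mset3 a b 0 x y := by
  rcases eq_or_ne b 0 with rfl | hb
  · refine ⟨List.range' 0 (a + 1), ?_, by simp [List.range'_succ], ?_⟩
    · rw [← List.range_eq_range', Multiset.coe_range]
    · rw [linDiffs_range']
      simp [mset3]
  have hax : x ≤ a + 1 := by omega
  have hdiv := Nat.div_add_mod' b x
  have hmod := Nat.mod_lt b (show 0 < x by omega)
  generalize b / x = m at hdiv
  generalize b % x = ρ at hdiv hmod
  obtain ⟨i, rfl⟩ := id hx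
  rcases Nat.even_or_odd' ρ with ⟨j, rfl | rfl⟩
  · obtain ⟨l₁, h₁⟩ := (isGrowing_range (y := y) hx hax).cycles hx m
    obtain ⟨l₂, h₂⟩ := h₁.insert_pairs hx j (by omega)
    rw [zero_add, hdiv] at h₂
    exact ⟨l₂, h₂.coe_eq, h₂.head, h₂.diffs⟩
  rcases Nat.eq_zero_or_pos j with rfl | hj
  · obtain ⟨t, rfl⟩ : ∃ t, a = t + (2 * i + 1) - 1 := ⟨a - 2 * i, by omega⟩
    have h₀ := isGrowing_range_append_reverse (y := y) (t := t) hx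
    cases m with
    | zero =>
      obtain rfl : b = 1 := by omega
      exact ⟨_, h₀.coe_eq, h₀.head, h₀.diffs⟩
    | succ m =>
      have h₁ := h₀.append hx (by omega)
      obtain ⟨l₂, h₂⟩ := h₁.cycles hx m
      obtain ⟨l₃, h₃⟩ := h₂.insert_pairs hx i (by omega)
      rw [show 1 + 1 + m * (2 * i + 1) + 2 * i = b by rw [← hdiv]; ring] at h₃
      exact ⟨l₃, h₃.coe_eq, h₃.head, h₃.diffs⟩
  · obtain ⟨t, rfl⟩ : ∃ t, a = t + (2 * i + 1) := ⟨a - (2 * i + 1), by omega⟩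
    obtain ⟨k, e, l, h₁, hk⟩ := exists_isTurning (y := y) (t := t) hx hx3 m
    obtain ⟨l₂, h₂⟩ := h₁.insert_pairs hx (j - 1) (by omega)
    rw [show 3 + m * (2 * i + 1) + 2 * (j - 1) = b by omega] at h₂
    exact ⟨l₂, h₂.coe_eq, h₂.head, h₂.diffs⟩

theorem IsGrowing.exists_eq_append {x y a b : ℕ} {l : List ℕ} (h : IsGrowing x y a b (a + b) l) :
    ∃ A : List ℕ, (A : Multiset ℕ) = Multiset.range (a + b) ∧
      (A ++ [a + b]).head? = some 0 ∧ linDiffs (A ++ [a + b]) = mset3 a b 0 x y := by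
  obtain ⟨A, rfl⟩ := List.getLast?_eq_some_iff.1 h.last
  refine ⟨A, ?_, h.head, h.diffs⟩
  have := h.coe_eq
  rwa [← Multiset.coe_add, Multiset.range_succ, add_comm, Multiset.coe_singleton,
    Multiset.singleton_add, Multiset.cons_inj_right] at this

/-- A perfect linear realization, without its last entry, of `{1^a, x^b}` with `x ∣ b`. -/
theorem exists_perfect {x y a m : ℕ} (hx : Odd x) (h : x ≤ a + 1) :
    ∃ A : List ℕ, (A : Multiset ℕ) = Multiset.range (a + m * x) ∧
      (A ++ [a + m * x]).head? = some 0 ∧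
      linDiffs (A ++ [a + m * x]) = mset3 a (m * x) 0 x y := by
  obtain ⟨l, hl⟩ := (isGrowing_range (y := y) hx h).cycles hx m
  simp only [zero_add, add_zero] at hl
  exact hl.exists_eq_append

/-- A perfect linear realization, without its last entry, of `{1^a, x^b}` with `x ∣ b - 2`. -/
theorem exists_perfect_two {x y a m : ℕ} (hx : Odd x) (h : x ≤ a + 1) :
    ∃ A : List ℕ, (A : Multiset ℕ) = Multiset.range (a + (2 + m * x)) ∧
      (A ++ [a + (2 + m * x)]).head? = some 0 ∧
      linDiffs (A ++ [a + (2 + m * x)]) = mset3 a (2 + m * x) 0 x y := by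
  obtain ⟨t, rfl⟩ : ∃ t, a = t + x - 1 := ⟨a + 1 - x, by omega⟩
  obtain ⟨l, hl⟩ := ((isGrowing_range_append_reverse (y := y) (t := t) hx).append hx
    (by obtain ⟨i, rfl⟩ := hx; omega)).cycles hx m
  rw [show t + x - 1 + 1 + 1 + m * x = t + x - 1 + (2 + m * x) by omega] at hl
  exact hl.exists_eq_append

/-! ### Paths through the columns -/

theorem exists_append_of_perfect_of_standard {x y r n γ δ β ε : ℕ}
    (hA : ∃ A : List ℕ, (A : Multiset ℕ) = Multiset.range r ∧ (A ++ [r]).head? = some 0 ∧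
      linDiffs (A ++ [r]) = mset3 γ δ 0 x y)
    (hB : ∃ l : List ℕ, (l : Multiset ℕ) = Multiset.range (β + ε + 1) ∧ l.head? = some 0 ∧
      linDiffs l = mset3 β ε 0 x y) (hn : β + ε + 1 = n) :
    ∃ A B : List ℕ, (A : Multiset ℕ) = Multiset.range r ∧
      (B : Multiset ℕ) = (Multiset.range n).map (r + ·) ∧ (A ++ B).head? = some 0 ∧
      linDiffs (A ++ B) = mset3 (γ + β) (δ + ε) 0 x y := by
  obtain ⟨A, hA, hA₀, hA'⟩ := hA
  obtain ⟨l, hl, hl₀, hl'⟩ := hB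
  obtain ⟨t, rfl⟩ := List.head?_eq_some_iff.1 hl₀
  refine ⟨A, (0 :: t).map (r + ·), hA, by rw [← Multiset.map_coe, hl, hn], ?_, ?_⟩
  · cases A with
    | nil => simpa using hA₀
    | cons a A => simpa using hA₀
  · rw [List.map_cons, linDiffs_append_cons, add_zero, hA']
    have := linDiffs_map_add r (0 :: t)
    rw [List.map_cons, add_zero] at this
    rw [this, hl', mset3_add]

theorem exists_perfect_run (x y r : ℕ) :
    ∃ A : List ℕ, (A : Multiset ℕ) = Multiset.range r ∧ (A ++ [r]).head? = some 0 ∧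
      linDiffs (A ++ [r]) = mset3 r 0 0 x y := by
  have h : List.range r ++ [r] = List.range' 0 (r + 1) := by
    rw [← List.range_succ, List.range_eq_range']
  refine ⟨List.range r, Multiset.coe_range r, ?_, ?_⟩
  · rw [h]
    simp [List.range'_succ]
  · rw [h, linDiffs_range']
    simp [mset3]

/-- A path through the columns `0, …, r + n - 1` that visits the first `r` columns first. The
number of differences `1` is at least `2x - 2`, and at most `6` if `x = 3` and `3x - 4` if not. -/
theorem exists_columns {x r n : ℕ} (y : ℕ) (hx : Odd x) (hx3 : 3 ≤ x) (hn : 1 ≤ n)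
    (hy : 2 * x ≤ r + n + 1) :
    ∃ A B : List ℕ, ∃ g h : ℕ, (A : Multiset ℕ) = Multiset.range r ∧
      (B : Multiset ℕ) = (Multiset.range n).map (r + ·) ∧ (A ++ B).head? = some 0 ∧
      linDiffs (A ++ B) = mset3 g h 0 x y ∧ g + h + 1 = r + n ∧ 2 * x ≤ g + 2 ∧
      ((x = 3 ∧ g ≤ 6) ∨ (5 ≤ x ∧ g + 4 ≤ 3 * x)) := by
  obtain ⟨γ, δ, β, ε, hr, hA, hβ, hn', hlo, hhi⟩ : ∃ γ δ β ε : ℕ, r = γ + δ ∧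
      (∃ A : List ℕ, (A : Multiset ℕ) = Multiset.range r ∧ (A ++ [r]).head? = some 0 ∧
        linDiffs (A ++ [r]) = mset3 γ δ 0 x y) ∧ (x ≤ β ∨ (x = 3 ∧ 2 ≤ β) ∨ ε = 0) ∧
      β + ε + 1 = n ∧ 2 * x ≤ γ + β + 2 ∧
      ((x = 3 ∧ γ + β ≤ 6) ∨ (5 ≤ x ∧ γ + β + 4 ≤ 3 * x)) := by
    have run := exists_perfect_run x y r
    have hx5 : x = 3 ∨ 5 ≤ x := by obtain ⟨i, rfl⟩ := hx; omega
    have hdm := fun s => Nat.div_add_mod' (r - s) x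
    have hml := fun s => Nat.mod_lt (r - s) (show 0 < x by omega)
    have one : ∀ m γ, r = γ + m * x → x ≤ γ + 1 → ∃ A : List ℕ,
        (A : Multiset ℕ) = Multiset.range r ∧ (A ++ [r]).head? = some 0 ∧
        linDiffs (A ++ [r]) = mset3 γ (m * x) 0 x y := by
      rintro m γ rfl hγ
      exact exists_perfect hx hγ
    have two : ∀ m γ, r = γ + (2 + m * x) → x ≤ γ + 1 → ∃ A : List ℕ,
        (A : Multiset ℕ) = Multiset.range r ∧ (A ++ [r]).head? = some 0 ∧
        linDiffs (A ++ [r]) = mset3 γ (2 + m * x) 0 x y := by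
      rintro m γ rfl hγ
      exact exists_perfect_two hx hγ
    rcases hx5 with rfl | hx5
    · by_cases hn3 : 3 ≤ n
      · by_cases hr : r ≤ 4
        · exact ⟨r, 0, min (n - 1) (6 - r), n - 1 - min (n - 1) (6 - r), by omega, run,
            by omega, by omega, by omega, by omega⟩
        · have h₁ := hdm 2
          have h₂ := hml 2
          generalize (r - 2) / 3 = m at h₁
          generalize (r - 2) % 3 = d at h₁ h₂
          exact ⟨2 + d, m * 3, 2, n - 3, by omega, one m _ (by omega) (by omega), by omega,
            by omega, by omega, by omega⟩
      · by_cases hr : r + n ≤ 7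
        · exact ⟨r, 0, n - 1, 0, by omega, run, by omega, by omega, by omega, by omega⟩
        · have h₁ := hdm (5 - n)
          have h₂ := hml (5 - n)
          generalize (r - (5 - n)) / 3 = m at h₁
          generalize (r - (5 - n)) % 3 = d at h₁ h₂
          exact ⟨5 - n + d, m * 3, n - 1, 0, by omega, one m _ (by omega) (by omega), by omega,
            by omega, by omega, by omega⟩
    · by_cases hnx : x + 1 ≤ n
      · by_cases hr : r + 4 ≤ 2 * x
        · exact ⟨r, 0, min (n - 1) (3 * x - 4 - r), n - 1 - min (n - 1) (3 * x - 4 - r),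
            by omega, run, by omega, by omega, by omega, by omega⟩
        · have h₁ := hdm (x - 1)
          have h₂ := hml (x - 1)
          generalize (r - (x - 1)) / x = m at h₁
          generalize (r - (x - 1)) % x = d at h₁ h₂
          by_cases hd : d + 3 ≤ x
          · exact ⟨x - 1 + d, m * x, x, n - 1 - x, by omega, one m _ (by omega) (by omega),
              by omega, by omega, by omega, by omega⟩
          · exact ⟨x - 1 + d - 2, 2 + m * x, x, n - 1 - x, by omega,
              two m _ (by omega) (by omega), by omega, by omega, by omega, by omega⟩
      · by_cases hr : r + n + 3 ≤ 3 * x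
        · exact ⟨r, 0, n - 1, 0, by omega, run, by omega, by omega, by omega, by omega⟩
        · have h₁ := hdm (2 * x - 1 - n)
          have h₂ := hml (2 * x - 1 - n)
          generalize (r - (2 * x - 1 - n)) / x = m at h₁
          generalize (r - (2 * x - 1 - n)) % x = d at h₁ h₂
          by_cases hd : d + 2 ≤ x
          · exact ⟨2 * x - 1 - n + d, m * x, n - 1, 0, by omega, one m _ (by omega) (by omega),
              by omega, by omega, by omega, by omega⟩
          · exact ⟨3 * x - 4 - n, 2 + m * x, n - 1, 0, by omega,
              two m _ (by omega) (by omega), by omega, by omega, by omega, by omega⟩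
  obtain ⟨A, B, h₁, h₂, h₃, h₄⟩ := exists_append_of_perfect_of_standard hA
    (exists_standard hx hx3 hβ) hn'
  exact ⟨A, B, γ + β, δ + ε, h₁, h₂, h₃, h₄, by omega, hlo, hhi⟩

/-! ### Lifting paths through columns -/

/-- The entries in rows `i, …, i + k - 1` of the column of `z`, in a grid of width `y`. -/
def colSegment (y z i k : ℕ) : List ℕ := (List.range' i k).map (z + · * y)

theorem colSegment_head? (y z i k : ℕ) : (colSegment y z i (k + 1)).head? = some (z + i * y) := by
  simp [colSegment, List.range'_succ]

theorem colSegment_getLast? (y z i k : ℕ) :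
    (colSegment y z i (k + 1)).getLast? = some (z + (i + k) * y) := by
  simp [colSegment, List.range'_concat]

theorem linDiffs_colSegment (y z i k : ℕ) :
    linDiffs (colSegment y z i (k + 1)) = Multiset.replicate k y := by
  induction k generalizing i with
  | zero => rfl
  | succ k ih =>
    have h : colSegment y z i (k + 1 + 1) = [z + i * y] ++ colSegment y z (i + 1) (k + 1) := by
      simp [colSegment, List.range'_succ]
    rw [h, linDiffs_append (p := z + i * y) rfl (colSegment_head? y z (i + 1) k), ih,
      linDiffs_singleton, zero_add, Multiset.replicate_succ, Multiset.singleton_add]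
    congr 1
    rw [add_mul, one_mul]
    omega

theorem coe_colSegment_add (y z i k k' : ℕ) :
    (colSegment y z i (k + k') : Multiset ℕ) = colSegment y z i k + colSegment y z (i + k) k' := by
  simp only [colSegment]
  rw [Multiset.coe_add, ← List.map_append]
  have := List.range'_append (s := i) (m := k) (n := k') (step := 1)
  rw [one_mul] at this
  rw [this]

/-- Traverse the columns of the list one after the other, column `c` having `H c` rows, upwards
and downwards in turn; the `i`-th column is traversed upwards if `i` is even. -/
def snake (y : ℕ) (H : ℕ → ℕ) : ℕ → List ℕ → List ℕ
  | _, [] => []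
  | i, c :: cs =>
      (if i % 2 = 0 then colSegment y c 0 (H c) else (colSegment y c 0 (H c)).reverse) ++
      snake y H (i + 1) cs

/-- The entry of column `c` at which the traversal by `snake` in direction `i` starts. -/
def entryPoint (y : ℕ) (H : ℕ → ℕ) (i c : ℕ) : ℕ :=
  if i % 2 = 0 then c else c + (H c - 1) * y

/-- Consecutive columns that are connected at the top have equal height. -/
def Matched (H : ℕ → ℕ) : ℕ → List ℕ → Prop
  | i, a :: b :: t => (i % 2 = 0 → H a = H b) ∧ Matched H (i + 1) (b :: t)
  | _, _ => True

theorem matched_of_forall_eq {H : ℕ → ℕ} {q : ℕ} {l : List ℕ} (h : ∀ c ∈ l, H c = q) (i : ℕ) :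
    Matched H i l := by
  induction l generalizing i with
  | nil => trivial
  | cons a l ih =>
    cases l with
    | nil => trivial
    | cons b l =>
      exact ⟨fun _ => by rw [h a (by simp), h b (by simp)],
        ih (fun c hc => h c (List.mem_cons_of_mem _ hc)) _⟩

theorem matched_append {H : ℕ → ℕ} {p q i : ℕ} {l₁ l₂ : List ℕ} (h₁ : ∀ c ∈ l₁, H c = p)
    (h₂ : ∀ c ∈ l₂, H c = q) (hi : (i + l₁.length) % 2 = 0) : Matched H i (l₁ ++ l₂) := by
  induction l₁ generalizing i with
  | nil => exact matched_of_forall_eq h₂ i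
  | cons a l ih =>
    have ih' := ih (fun c hc => h₁ c (List.mem_cons_of_mem _ hc)) (i := i + 1)
      (by simp only [List.length_cons] at hi; omega)
    cases l with
    | nil =>
      cases l₂ with
      | nil => trivial
      | cons b l₂ => exact ⟨fun h => by simp at hi; omega, ih'⟩
    | cons b l => exact ⟨fun _ => by rw [h₁ a (by simp), h₁ b (by simp)], ih'⟩

theorem Matched.of_append {H : ℕ → ℕ} {i z w : ℕ} {l : List ℕ}
    (h : Matched H i (l ++ [z, w])) :
    Matched H i (l ++ [z]) ∧ ((i + l.length) % 2 = 0 → H z = H w) := by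
  induction l generalizing i with
  | nil => exact ⟨trivial, h.1⟩
  | cons a l ih =>
    cases l with
    | nil =>
      refine ⟨⟨h.1, trivial⟩, fun h' => h.2.1 h'⟩
    | cons b l =>
      obtain ⟨h₁, h₂⟩ := ih h.2
      refine ⟨⟨h.1, h₁⟩, fun h' => h₂ ?_⟩
      simp only [List.length_cons] at h' ⊢
      omega

theorem coe_snake (y : ℕ) (H : ℕ → ℕ) (i : ℕ) (l : List ℕ) :
    (snake y H i l : Multiset ℕ) = (l : Multiset ℕ).bind fun c => colSegment y c 0 (H c) := by
  induction l generalizing i with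
  | nil => rfl
  | cons c l ih =>
    rw [snake, ← Multiset.coe_add, ih, ← Multiset.cons_coe, Multiset.cons_bind]
    split_ifs
    · rfl
    · rw [Multiset.coe_reverse]

theorem snake_append_head? {y : ℕ} {H : ℕ → ℕ} {i z b : ℕ} {l s W : List ℕ}
    (hH : ∀ c ∈ l, 1 ≤ H c) (hW : W.head? = some (entryPoint y H (i + l.length) z))
    (hb : l ++ [z] = b :: s) : (snake y H i l ++ W).head? = some (entryPoint y H i b) := by
  cases l with
  | nil =>
    simp only [List.nil_append, List.cons.injEq] at hb
    rw [snake, List.nil_append, hW, hb.1]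
    rfl
  | cons a l =>
    simp only [List.cons_append, List.cons.injEq] at hb
    obtain ⟨k, hk⟩ := Nat.exists_eq_add_of_le' (hH a (by simp))
    rw [snake, ← hb.1, hk]
    unfold entryPoint
    split_ifs
    · simp [colSegment_head?]
    · simp [colSegment_getLast?, hk]

theorem exists_linDiffs_snake_append {y : ℕ} {H : ℕ → ℕ} {i z : ℕ} {l W : List ℕ}
    (hH : ∀ c ∈ l, 1 ≤ H c) (hW : W.head? = some (entryPoint y H (i + l.length) z))
    (hm : Matched H i (l ++ [z])) :
    ∃ k, linDiffs (snake y H i l ++ W) =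
      linDiffs (l ++ [z]) + Multiset.replicate k y + linDiffs W := by
  induction l generalizing i with
  | nil => exact ⟨0, by simp [snake]⟩
  | cons a l ih =>
    obtain ⟨b, s, hs⟩ : ∃ b s, l ++ [z] = b :: s := by cases l <;> simp
    have hH' : ∀ c ∈ l, 1 ≤ H c := fun c hc => hH c (List.mem_cons_of_mem _ hc)
    have hW' : W.head? = some (entryPoint y H (i + 1 + l.length) z) := by
      rw [hW, List.length_cons]
      congr 2
      omega
    rw [List.cons_append, hs] at hm
    obtain ⟨k, hk⟩ := ih hH' hW' (hs ▸ hm.2)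
    obtain ⟨j, hj⟩ := Nat.exists_eq_add_of_le' (hH a (by simp))
    refine ⟨j + k, ?_⟩
    have hd : linDiffs (snake y H i (a :: l) ++ W) = Multiset.replicate j y + {(a - b) + (b - a)} +
        linDiffs (snake y H (i + 1) l ++ W) := by
      have hh := snake_append_head? hH' hW' hs
      have hHab := hm.1
      rw [snake, List.append_assoc]
      unfold entryPoint at hh
      by_cases hi : i % 2 = 0
      · rw [if_pos hi, linDiffs_append (by rw [hj]; exact colSegment_getLast? y a 0 j) hh, hj,
          linDiffs_colSegment, if_neg (by omega), ← hHab hi, hj]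
        congr 3
        simp only [zero_add, Nat.add_sub_cancel]
        omega
      · rw [if_neg hi, linDiffs_append (p := a) (by rw [hj]; simp [colSegment_head?]) hh, hj,
          linDiffs_reverse, linDiffs_colSegment, if_pos (by omega)]
    rw [hd, hk, List.cons_append, hs, linDiffs_cons_cons, Multiset.replicate_add]
    abel

theorem bind_colSegment_range (y q : ℕ) :
    ((Multiset.range y).bind fun c => (colSegment y c 0 q : Multiset ℕ)) =
      Multiset.range (q * y) := by
  induction q with
  | zero => simp [colSegment]
  | succ q ih =>
    have h : ∀ c, (colSegment y c 0 (q + 1) : Multiset ℕ) = colSegment y c 0 q + {q * y + c} := by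
      intro c
      rw [coe_colSegment_add, zero_add, add_comm (q * y)]
      rfl
    simp only [h]
    rw [Multiset.bind_add, ih, Multiset.bind_singleton, add_mul, one_mul, Multiset.range_add]

theorem bind_colSegment_ite {r n q : ℕ} :
    ((Multiset.range r + (Multiset.range n).map (r + ·)).bind
      fun c => (colSegment (r + n) c 0 (if c < r then q + 1 else q) : Multiset ℕ)) =
      Multiset.range (q * (r + n) + r) := by
  have h₁ : ((Multiset.range r).bind
      fun c => (colSegment (r + n) c 0 (if c < r then q + 1 else q) : Multiset ℕ)) =
      ((Multiset.range r).bind fun c => (colSegment (r + n) c 0 q : Multiset ℕ)) +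
        (Multiset.range r).map (q * (r + n) + ·) := by
    rw [← Multiset.bind_singleton, ← Multiset.bind_add]
    refine Multiset.bind_congr fun c hc => ?_
    rw [if_pos (Multiset.mem_range.1 hc), coe_colSegment_add, zero_add, add_comm (q * (r + n))]
    rfl
  have h₂ : (((Multiset.range n).map (r + ·)).bind
      fun c => (colSegment (r + n) c 0 (if c < r then q + 1 else q) : Multiset ℕ)) =
      (((Multiset.range n).map (r + ·)).bind fun c => (colSegment (r + n) c 0 q : Multiset ℕ)) := by
    refine Multiset.bind_congr fun c hc => ?_
    obtain ⟨j, -, rfl⟩ := Multiset.mem_map.1 hc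
    rw [if_neg (by omega)]
  rw [Multiset.add_bind, h₁, h₂, add_right_comm, ← Multiset.add_bind, ← Multiset.range_add,
    bind_colSegment_range, ← Multiset.range_add]

theorem snake_append_singleton (y : ℕ) (H : ℕ → ℕ) (i z : ℕ) (l : List ℕ) :
    snake y H i (l ++ [z]) = snake y H i l ++ (if (i + l.length) % 2 = 0 then
      colSegment y z 0 (H z) else (colSegment y z 0 (H z)).reverse) := by
  induction l generalizing i with
  | nil => simp [snake]
  | cons a l ih =>
    rw [List.cons_append, snake, snake, ih, List.append_assoc, List.length_cons,
      add_right_comm, add_assoc i l.length 1]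

theorem exists_linDiffs_snake {y : ℕ} {H : ℕ → ℕ} {l : List ℕ} {b : ℕ} (hl : l.head? = some b)
    (hH : ∀ c ∈ l, 1 ≤ H c) (hm : Matched H 0 l) :
    (snake y H 0 l).head? = some b ∧
      ∃ k, linDiffs (snake y H 0 l) = linDiffs l + Multiset.replicate k y := by
  obtain rfl | ⟨s, z, rfl⟩ := l.eq_nil_or_concat'
  · simp at hl
  obtain ⟨j, hj⟩ := Nat.exists_eq_add_of_le' (hH z (by simp))
  have hW : (if (0 + s.length) % 2 = 0 then colSegment y z 0 (H z) else
      (colSegment y z 0 (H z)).reverse).head? = some (entryPoint y H (0 + s.length) z) := by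
    unfold entryPoint
    rw [hj]
    split_ifs
    · simp [colSegment_head?]
    · simp [colSegment_getLast?]
  have hH' : ∀ c ∈ s, 1 ≤ H c := fun c hc => hH c (by simp [hc])
  obtain ⟨t, ht⟩ := List.head?_eq_some_iff.1 hl
  rw [snake_append_singleton]
  refine ⟨snake_append_head? hH' hW ht, ?_⟩
  obtain ⟨k, hk⟩ := exists_linDiffs_snake_append hH' hW hm
  refine ⟨k + j, ?_⟩
  rw [hk, add_assoc, Multiset.replicate_add, hj]
  congr 2
  split_ifs
  · exact linDiffs_colSegment y z 0 j
  · rw [linDiffs_reverse, linDiffs_colSegment]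

theorem replicate_y_eq_mset3 (k x y : ℕ) : Multiset.replicate k y = mset3 0 0 k x y := by
  simp [mset3]

theorem length_of_coe_eq_range {l : List ℕ} {n : ℕ} (h : (l : Multiset ℕ) = Multiset.range n) :
    l.length = n := by
  rw [← Multiset.coe_card, h, Multiset.card_range]

/-- The case in which the number of differences `y` is `q * y + r` with `r` even. -/
theorem exists_grid_of_even {x y r n q : ℕ} (hx : Odd x) (hx3 : 3 ≤ x) (hn : 1 ≤ n)
    (hy : r + n = y) (hxy : 2 * x ≤ y + 1) (hr : r % 2 = 0) :
    ∃ (G : List ℕ) (α β : ℕ), (G : Multiset ℕ) = Multiset.range (α + β + (q * y + r) + 1) ∧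
      G.head? = some 0 ∧ linDiffs G = mset3 α β (q * y + r) x y ∧ β + 2 * x ≤ y + 2 ∧
      ((x = 3 ∧ α ≤ 7) ∨ (5 ≤ x ∧ α + 3 ≤ 3 * x)) := by
  subst hy
  obtain ⟨A, B, g, h, hA, hB, h₀, hd, hgh, hlo, hhi⟩ :=
    exists_columns (r + n) hx hx3 hn (by omega)
  have hmA : ∀ c ∈ A, (if c < r then q + 1 + 1 else q + 1) = q + 1 + 1 := fun c hc => by
    rw [if_pos]
    rwa [← Multiset.mem_coe, hA, Multiset.mem_range] at hc
  have hmB : ∀ c ∈ B, (if c < r then q + 1 + 1 else q + 1) = q + 1 := fun c hc => by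
    rw [← Multiset.mem_coe, hB, Multiset.mem_map] at hc
    obtain ⟨j, -, rfl⟩ := hc
    rw [if_neg (by omega)]
  obtain ⟨h₁, k, hk⟩ := exists_linDiffs_snake (y := r + n)
    (H := fun c => if c < r then q + 1 + 1 else q + 1) h₀ (fun c _ => by split_ifs <;> omega)
    (matched_append hmA hmB (by rw [length_of_coe_eq_range hA]; omega))
  have hcoe := coe_snake (r + n) (fun c => if c < r then q + 1 + 1 else q + 1) 0 (A ++ B)
  rw [← Multiset.coe_add, hA, hB, bind_colSegment_ite, Nat.succ_mul] at hcoe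
  have hcard := card_linDiffs (snake (r + n) (fun c => if c < r then q + 1 + 1 else q + 1) 0
    (A ++ B))
  rw [hd, replicate_y_eq_mset3 _ x, mset3_add] at hk
  rw [length_of_coe_eq_range hcoe, hk, card_mset3] at hcard
  obtain rfl : k = q * (r + n) + r := by omega
  refine ⟨_, g, h, ?_, h₁, ?_, by omega, by omega⟩
  · rw [hcoe]
    congr 1
    omega
  · rw [hk, zero_add, add_zero, add_zero]

theorem exists_twist {y z w H₁ H₂ : ℕ} (i : ℕ) (h₂ : 2 ≤ H₂) (h₁₂ : H₂ ≤ H₁)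
    (hi : i % 2 = 0 → H₁ = H₂) :
    ∃ (W : List ℕ) (k : ℕ),
      (W : Multiset ℕ) = (colSegment y z 0 H₁ : Multiset ℕ) + colSegment y w 0 H₂ ∧
      W.head? = some (if i % 2 = 0 then z else z + (H₁ - 1) * y) ∧
      linDiffs W = {(z - w) + (w - z)} + {(z - w) + (w - z)} + Multiset.replicate k y := by
  obtain ⟨j, rfl⟩ := Nat.exists_eq_add_of_le' h₂
  by_cases h : i % 2 = 0
  · obtain rfl := hi h
    refine ⟨colSegment y z 0 (0 + 1) ++ (colSegment y w 0 (j + 1 + 1) ++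
      (colSegment y z 1 (j + 1)).reverse), 0 + (j + 1 + j), ?_, ?_, ?_⟩
    · rw [show j + 2 = 0 + 1 + (j + 1) by omega, coe_colSegment_add y z 0 (0 + 1)]
      simp only [← Multiset.coe_add, Multiset.coe_reverse, zero_add]
      abel
    · simp [h, colSegment_head?]
    · have hh : (colSegment y w 0 (j + 1 + 1) ++ (colSegment y z 1 (j + 1)).reverse).head? =
          some w := by
        rw [List.head?_append, colSegment_head?]
        simp
      rw [linDiffs_append (p := z) (by rw [colSegment_getLast?]; simp) hh,
        linDiffs_append (q := z + (1 + j) * y) (colSegment_getLast? y w 0 (j + 1))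
          (by rw [List.head?_reverse, colSegment_getLast?]), linDiffs_reverse,
        linDiffs_colSegment, linDiffs_colSegment, linDiffs_colSegment]
      have e : w + (0 + (j + 1)) * y - (z + (1 + j) * y) +
          (z + (1 + j) * y - (w + (0 + (j + 1)) * y)) = (z - w) + (w - z) := by
        rw [zero_add, add_comm 1 j]
        omega
      rw [e]
      simp only [Multiset.replicate_add]
      abel
  · obtain ⟨m, rfl⟩ := Nat.exists_eq_add_of_le h₁₂
    refine ⟨(colSegment y z (j + 1) (m + 1)).reverse ++ ((colSegment y w 0 (j + 1 + 1)).reverse ++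
      colSegment y z 0 (j + 1)), m + (j + 1 + j), ?_, ?_, ?_⟩
    · rw [show j + 2 + m = j + 1 + (m + 1) by omega, coe_colSegment_add y z 0 (j + 1), zero_add]
      simp only [← Multiset.coe_add, Multiset.coe_reverse]
      abel
    · rw [List.head?_append, List.head?_reverse, colSegment_getLast?, if_neg h]
      simp only [Option.some_or, Option.some.injEq]
      congr 2
      omega
    · have hh : ((colSegment y w 0 (j + 1 + 1)).reverse ++ colSegment y z 0 (j + 1)).head? =
          some (w + (0 + (j + 1)) * y) := by
        rw [List.head?_append, List.head?_reverse, colSegment_getLast?]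
        simp
      rw [linDiffs_append (by rw [List.getLast?_reverse, colSegment_head?]) hh,
        linDiffs_append (by rw [List.getLast?_reverse, colSegment_head?])
          (colSegment_head? y z 0 j), linDiffs_reverse, linDiffs_reverse,
        linDiffs_colSegment, linDiffs_colSegment, linDiffs_colSegment]
      have e₁ : z + (j + 1) * y - (w + (0 + (j + 1)) * y) +
          (w + (0 + (j + 1)) * y - (z + (j + 1) * y)) = (z - w) + (w - z) := by
        rw [zero_add]
        omega
      have e₂ : w + 0 * y - (z + 0 * y) + (z + 0 * y - (w + 0 * y)) = (z - w) + (w - z) := by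
        omega
      rw [e₁, e₂]
      simp only [Multiset.replicate_add]
      abel

/-- The case in which the number of differences `y` is `(q + 1) * y + r - 1` with `r` even. -/
theorem exists_grid_of_odd {x y r n q c : ℕ} (hx : Odd x) (hx3 : 3 ≤ x) (hn : 1 ≤ n)
    (hy : r + n = y) (hxy : 2 * x ≤ y + 1) (hr : r % 2 = 0) (hc : c + 1 = (q + 1) * y + r) :
    ∃ (G : List ℕ) (α β : ℕ), (G : Multiset ℕ) = Multiset.range (α + β + c + 1) ∧
      G.head? = some 0 ∧ linDiffs G = mset3 α β c x y ∧ β + 2 * x ≤ y + 2 ∧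
      ((x = 3 ∧ α ≤ 7) ∨ (5 ≤ x ∧ α + 3 ≤ 3 * x)) := by
  subst hy
  obtain ⟨A, B, g, h, hA, hB, h₀, hd, hgh, hlo, hhi⟩ :=
    exists_columns (r + n) hx hx3 hn (by omega)
  have hmA : ∀ c ∈ A, (if c < r then q + 2 + 1 else q + 2) = q + 2 + 1 := fun c hc => by
    rw [if_pos]
    rwa [← Multiset.mem_coe, hA, Multiset.mem_range] at hc
  have hmB : ∀ c ∈ B, (if c < r then q + 2 + 1 else q + 2) = q + 2 := fun c hc => by
    rw [← Multiset.mem_coe, hB, Multiset.mem_map] at hc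
    obtain ⟨j, -, rfl⟩ := hc
    rw [if_neg (by omega)]
  have hlenA := length_of_coe_eq_range hA
  have hlenB : B.length = n := by
    rw [← Multiset.coe_card, hB, Multiset.card_map, Multiset.card_range]
  have hm := matched_append (i := 0) hmA hmB (by omega)
  have hcoe := bind_colSegment_ite (r := r) (n := n) (q := q + 2)
  rw [← hA, ← hB, Multiset.coe_add] at hcoe
  obtain rfl | ⟨B, w, rfl⟩ := B.eq_nil_or_concat'
  · simp at hlenB
    omega
  obtain hnil | ⟨s, z, hs⟩ := (A ++ B).eq_nil_or_concat'
  · rw [List.append_eq_nil_iff] at hnil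
    simp only [hnil, List.length_nil, List.length_append, List.length_singleton] at hlenA hlenB
    omega
  have hcs : A ++ (B ++ [w]) = s ++ [z, w] := by
    rw [← List.append_assoc, hs]
    simp
  rw [hcs] at hm hcoe hd h₀
  obtain ⟨hm₁, hm₂⟩ := Matched.of_append (H := fun c => if c < r then q + 2 + 1 else q + 2) hm
  have hw := hmB w (by simp)
  obtain ⟨W, k', hW, hW₀, hW'⟩ := exists_twist (y := r + n) (z := z) (w := w)
    (H₁ := if z < r then q + 2 + 1 else q + 2) (H₂ := if w < r then q + 2 + 1 else q + 2)
    (0 + s.length) (by omega) (by rw [hw]; split_ifs <;> omega) hm₂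
  have hH : ∀ c ∈ s, 1 ≤ (fun c => if c < r then q + 2 + 1 else q + 2) c := fun c _ => by
    dsimp only
    split_ifs <;> omega
  obtain ⟨k, hk⟩ := exists_linDiffs_snake_append hH hW₀ hm₁
  have hhead : (snake (r + n) (fun c => if c < r then q + 2 + 1 else q + 2) 0 s ++ W).head? =
      some 0 := by
    obtain ⟨t, ht⟩ : ∃ t, s ++ [z] = 0 :: t := by
      rw [← List.head?_eq_some_iff]
      cases s <;> simpa using h₀
    exact snake_append_head? hH hW₀ ht
  have hG : ((snake (r + n) (fun c => if c < r then q + 2 + 1 else q + 2) 0 s ++ W : List ℕ) :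
      Multiset ℕ) = Multiset.range ((q + 2) * (r + n) + r) := by
    rw [← hcoe, ← Multiset.coe_add, ← Multiset.coe_add, coe_snake, hW, Multiset.add_bind]
    congr 1
    simp [← Multiset.cons_coe]
  have hsplit : linDiffs (s ++ [z]) + {(z - w) + (w - z)} = mset3 g h 0 x (r + n) := by
    rw [← hd, linDiffs_append_cons s z [w], linDiffs_cons_cons, linDiffs_singleton, add_zero]
  have hhop : (z - w) + (w - z) = 1 ∨ (z - w) + (w - z) = x := by
    have : (z - w) + (w - z) ∈ mset3 g h 0 x (r + n) := by
      rw [← hsplit]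
      simp
    simp only [mset3, Multiset.mem_add, Multiset.mem_replicate] at this
    tauto
  have hk' : linDiffs (snake (r + n) (fun c => if c < r then q + 2 + 1 else q + 2) 0 s ++ W) =
      mset3 g h (k + k') x (r + n) + {(z - w) + (w - z)} := by
    rw [hk, hW']
    calc _ = linDiffs (s ++ [z]) + {(z - w) + (w - z)} + (Multiset.replicate k (r + n) +
          Multiset.replicate k' (r + n)) + {(z - w) + (w - z)} := by abel
      _ = _ := by
        rw [hsplit, ← Multiset.replicate_add, replicate_y_eq_mset3 _ x, mset3_add, add_zero,
          add_zero, zero_add]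
  have hcard := card_linDiffs
    (snake (r + n) (fun c => if c < r then q + 2 + 1 else q + 2) 0 s ++ W)
  rw [length_of_coe_eq_range hG, hk', Multiset.card_add, card_mset3,
    Multiset.card_singleton] at hcard
  have hq : (q + 2) * (r + n) = (q + 1) * (r + n) + (r + n) := by ring
  obtain rfl : c = k + k' := by omega
  rw [show (q + 2) * (r + n) + r = g + h + (k + k') + 1 + 1 by omega] at hG
  rcases hhop with hhop | hhop
  · rw [hhop, singleton_one_eq_mset3 x (r + n), mset3_add] at hk'
    refine ⟨_, g + 1, h, ?_, hhead, hk', by omega, by omega⟩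
    rw [hG]
    congr 1
    omega
  · rw [hhop, singleton_x_eq_mset3 x (r + n), mset3_add] at hk'
    refine ⟨_, g, h + 1, ?_, hhead, hk', by omega, by omega⟩
    rw [hG]
    congr 1
    omega

theorem linDiffs_append_add_linDiffs {l₁ l₂ l₃ : List ℕ} {p : ℕ} (h₂ : l₂.head? = some p)
    (h₃ : l₃.head? = some p) :
    linDiffs (l₁ ++ l₂) + linDiffs l₃ = linDiffs (l₁ ++ l₃) + linDiffs l₂ := by
  obtain ⟨s, rfl⟩ := List.head?_eq_some_iff.1 h₂
  obtain ⟨t, rfl⟩ := List.head?_eq_some_iff.1 h₃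
  rw [linDiffs_append_cons l₁ p s, linDiffs_append_cons l₁ p t, add_right_comm]

theorem map_sub_range_eq_map_add {y n : ℕ} (h : n ≤ y) :
    (Multiset.range n).map (fun j => y - (y - n + j)) = (Multiset.range n).map (1 + ·) := by
  conv_lhs => rw [← map_sub_range n, Multiset.map_map]
  refine Multiset.map_congr rfl fun j hj => ?_
  rw [Multiset.mem_range] at hj
  simp only [Function.comp_apply]
  omega

/-- The case of a few differences `y`: the path starts with the edge from `0` to `y`, the last
`n` of the remaining `y` columns have height `q`. -/
theorem exists_grid_of_start {x y r n q c : ℕ} (hx : Odd x) (hx3 : 3 ≤ x) (hn : 1 ≤ n)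
    (hy : r + n = y) (hxy : 2 * x ≤ y + 1) (hq : (q = 1 ∧ c = 1) ∨ (q = 2 ∧ c = n + 1)) :
    ∃ (G : List ℕ) (α β : ℕ), (G : Multiset ℕ) = Multiset.range (α + β + c + 1) ∧
      G.head? = some 0 ∧ linDiffs G = mset3 α β c x y ∧ β + 2 * x ≤ y + 2 ∧
      ((x = 3 ∧ α ≤ 7) ∨ (5 ≤ x ∧ α + 3 ≤ 3 * x)) := by
  subst hy
  obtain ⟨A, B, g, h, hA, hB, h₀, hd, hgh, hlo, hhi⟩ :=
    exists_columns (r + n) hx hx3 hn (by omega)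
  obtain ⟨b, B', rfl⟩ : ∃ b B', B = b :: B' := by
    cases B with
    | nil =>
      have := congrArg Multiset.card hB
      simp only [Multiset.coe_nil, Multiset.card_zero, Multiset.card_map,
        Multiset.card_range] at this
      omega
    | cons b B' => exact ⟨b, B', rfl⟩
  set B := b :: B' with hBdef
  have hle : ∀ c ∈ A ++ B, c ≤ r + n := fun c hc => by
    have : c ∈ ((A ++ B : List ℕ) : Multiset ℕ) := hc
    rw [← Multiset.coe_add, hA, hB, ← Multiset.range_add, Multiset.mem_range] at this
    omega
  have hBm : ((B.map (r + n - ·) : List ℕ) : Multiset ℕ) = (Multiset.range n).map (1 + ·) := by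
    rw [← Multiset.map_coe, hB, Multiset.map_map, ← map_sub_range_eq_map_add (y := r + n)
      (by omega), Nat.add_sub_cancel]
    rfl
  have hABm : ((A.map (r + n - ·) : List ℕ) : Multiset ℕ) +
      ((B.map (r + n - ·) : List ℕ) : Multiset ℕ) =
      (Multiset.range (r + n)).map (1 + ·) := by
    rw [← map_sub_range_eq_map_add le_rfl, Multiset.coe_add, ← List.map_append,
      ← Multiset.map_coe, ← Multiset.coe_add, hA, hB, ← Multiset.range_add]
    simp
  have hbm : (B.map (r + n - ·)).head? = some (r + n - b) := rfl
  obtain ⟨h₁, k, hk⟩ := exists_linDiffs_snake (y := r + n) (H := fun _ => q) hbm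
    (fun c _ => by omega) (matched_of_forall_eq (q := q) (fun _ _ => rfl) 0)
  have hcoe := coe_snake (r + n) (fun _ => q) 0 (B.map (r + n - ·))
  set S := snake (r + n) (fun _ => q) 0 (B.map (r + n - ·))
  have hdS : linDiffs (A.map (r + n - ·) ++ S) = mset3 g h k x (r + n) := by
    have := linDiffs_append_add_linDiffs (l₁ := A.map (r + n - ·)) h₁ hbm
    rw [← List.map_append, linDiffs_map_sub hle, hd, hk, replicate_y_eq_mset3 k x] at this
    have h' : mset3 g h k x (r + n) = mset3 g h 0 x (r + n) + mset3 0 0 k x (r + n) := by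
      rw [mset3_add, zero_add, add_zero, add_zero]
    rw [h']
    refine add_right_cancel (this.trans ?_)
    abel
  have hhead : (A.map (r + n - ·) ++ S).head? = some (r + n) := by
    cases A with
    | nil =>
      simp only [List.nil_append, hBdef, List.head?_cons, Option.some.injEq] at h₀
      rw [List.map_nil, List.nil_append, h₁, h₀, Nat.sub_zero]
    | cons a A =>
      simp only [List.cons_append, List.head?_cons, Option.some.injEq] at h₀
      simp [h₀]
  have hG : ((0 :: (A.map (r + n - ·) ++ S) : List ℕ) : Multiset ℕ) =
      Multiset.range (r + n + c) := by
    rw [← Multiset.cons_coe, ← Multiset.coe_add, hcoe]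
    have h0 : ∀ m, 0 ::ₘ (Multiset.range m).map (1 + ·) = Multiset.range (1 + m) := fun m => by
      rw [Multiset.range_add]
      rfl
    have hsing : ∀ s : Multiset ℕ, (s.bind fun c => {c}) = s := fun s =>
      (Multiset.bind_singleton s id).trans (Multiset.map_id s)
    rcases hq with ⟨rfl, rfl⟩ | ⟨rfl, rfl⟩
    · have : ∀ c, colSegment (r + n) c 0 1 = [c] := fun c => by simp [colSegment]
      simp only [this, Multiset.coe_singleton]
      rw [hsing, hABm, h0, add_comm]
    · have : ∀ c, (colSegment (r + n) c 0 2 : Multiset ℕ) = {c} + {r + n + c} := fun c => by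
        simp [colSegment, List.range'_succ, add_comm]
        rfl
      simp only [this, Multiset.bind_add, Multiset.bind_singleton]
      rw [hsing, ← add_assoc, hABm, hBm, ← Multiset.cons_add, h0, Multiset.map_map,
        show r + n + (n + 1) = 1 + (r + n) + n by omega, Multiset.range_add (1 + (r + n))]
      congr 1
      refine Multiset.map_congr rfl fun j _ => ?_
      simp only [Function.comp_apply]
      omega
  have hdG : linDiffs (0 :: (A.map (r + n - ·) ++ S)) = mset3 g h (k + 1) x (r + n) := by
    rw [← List.singleton_append, linDiffs_append (p := 0) rfl hhead, hdS, linDiffs_singleton,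
      zero_add, show 0 - (r + n) + (r + n - 0) = r + n by omega,
      singleton_y_eq_mset3 x (r + n), mset3_add, zero_add, zero_add, add_comm 1 k]
  have hcard := card_linDiffs (0 :: (A.map (r + n - ·) ++ S))
  rw [length_of_coe_eq_range hG, hdG, card_mset3] at hcard
  obtain rfl : c = k + 1 := by omega
  refine ⟨_, g, h, ?_, rfl, hdG, by omega, by omega⟩
  rw [hG]
  congr 1
  omega

/-! ### Gluing -/

theorem hasLinearRealization_of_glue {S G : List ℕ} {m n a b c x y : ℕ}
    (hS : (S : Multiset ℕ) = Multiset.range m) (hS₀ : S.head? = some 0)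
    (hG : (G : Multiset ℕ) = Multiset.range n) (hG₀ : G.head? = some 0)
    (h : linDiffs S + linDiffs G = mset3 a b c x y) :
    HasLinearRealization (mset3 a b c x y) := by
  obtain ⟨S, rfl⟩ := List.head?_eq_some_iff.1 hS₀
  obtain ⟨G, rfl⟩ := List.head?_eq_some_iff.1 hG₀
  obtain ⟨m, rfl⟩ : ∃ k, m = k + 1 := ⟨S.length, (length_of_coe_eq_range hS).symm⟩
  obtain ⟨n, rfl⟩ : ∃ k, n = k + 1 := ⟨G.length, (length_of_coe_eq_range hG).symm⟩
  have hle : ∀ s ∈ 0 :: S, s ≤ m := fun s hs => by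
    rw [← Multiset.mem_coe, hS, Multiset.mem_range] at hs
    omega
  have hr : ((0 :: S).map (m - ·)).reverse = (S.map (m - ·)).reverse ++ [m] := by simp
  have hd : linDiffs ((S.map (m - ·)).reverse ++ (0 :: G).map (m + ·)) = mset3 a b c x y := by
    rw [List.map_cons, linDiffs_append_cons, add_zero, ← hr, linDiffs_reverse,
      linDiffs_map_sub hle, ← h, ← linDiffs_map_add m (0 :: G)]
    simp
  refine ⟨_, ?_, hd⟩
  have hcard : (mset3 a b c x y).card + 1 = m + (n + 1) := by
    rw [← hd, card_linDiffs]
    have h₁ := length_of_coe_eq_range hS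
    have h₂ := length_of_coe_eq_range hG
    simp only [List.length_cons] at h₁ h₂
    simp only [List.length_append, List.length_reverse, List.length_map, List.length_cons]
    omega
  rw [hcard, ← Multiset.coe_eq_coe, Multiset.coe_range, Multiset.range_add, ← hG,
    ← Multiset.coe_add, Multiset.map_coe, Multiset.coe_reverse]
  congr 1
  have h₁ := map_sub_range (m + 1)
  rw [← hS, Nat.add_sub_cancel, Multiset.map_coe, hS, Multiset.range_succ, List.map_cons,
    ← Multiset.cons_coe, Nat.sub_zero] at h₁
  exact Multiset.cons_inj_right m |>.1 h₁

theorem exists_grid {x y : ℕ} (c : ℕ) (hx : Odd x) (hx3 : 3 ≤ x) (hxy : 2 * x ≤ y + 1) :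
    ∃ (G : List ℕ) (α β : ℕ), (G : Multiset ℕ) = Multiset.range (α + β + c + 1) ∧
      G.head? = some 0 ∧ linDiffs G = mset3 α β c x y ∧ β + 2 * x ≤ y + 2 ∧
      ((x = 3 ∧ α ≤ 7) ∨ (5 ≤ x ∧ α + 3 ≤ 3 * x)) := by
  have hy : 0 < y := by omega
  have hc := Nat.div_add_mod' c y
  have hc' := Nat.div_add_mod' (c + 1) y
  have hlt := Nat.mod_lt c hy
  have hlt' := Nat.mod_lt (c + 1) hy
  rcases Nat.mod_two_eq_zero_or_one (c % y) with hr | hr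
  · rw [← hc]
    exact exists_grid_of_even hx hx3 (by omega) (Nat.add_sub_of_le hlt.le) hxy hr
  · by_cases hcy : y ≤ c + 1
    · obtain ⟨q, hq⟩ := Nat.exists_eq_add_of_le' ((Nat.one_le_div_iff hy).2 hcy)
      rw [hq] at hc'
      refine exists_grid_of_odd hx hx3 (by omega) (Nat.add_sub_of_le hlt'.le) hxy ?_ hc'.symm
      rw [← Nat.mod_add_mod] at hc' ⊢
      obtain h | h : c % y + 1 < y ∨ c % y + 1 = y := by omega
      · rw [Nat.mod_eq_of_lt h]
        omega
      · rw [h, Nat.mod_self]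
    · rw [Nat.mod_eq_of_lt (show c < y by omega)] at hr
      by_cases h1 : c = 1
      · exact exists_grid_of_start hx hx3 hy (zero_add y) hxy (Or.inl ⟨rfl, h1⟩)
      · exact exists_grid_of_start (r := y - (c - 1)) (n := c - 1) hx hx3 (by omega) (by omega) hxy
          (Or.inr ⟨rfl, by omega⟩)

/-- Let `x ≥ 3` be odd and `y > x` with `y > 2x - 2`. If
`a ≥ 4x - 3` and `b ≥ y - 2x + 2` then `{1^a, x^b, y^c}` has a linear
realization. (The inequality `b ≥ y - 2x + 2` is written subtraction-free as
`b + 2x ≥ y + 2`.) -/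
theorem stmt8 (x y a b c : ℕ) (hx : 3 ≤ x) (hxo : Odd x) (hxy : x < y)
    (hy : 2 * x - 2 < y) (ha : 4 * x - 3 ≤ a) (hb : y + 2 ≤ b + 2 * x) :
    HasLinearRealization (mset3 a b c x y) := by
  obtain ⟨G, α, β, hG, hG₀, hd, hβ, hα⟩ := exists_grid c hxo hx (y := y) (by omega)
  obtain ⟨a, rfl⟩ := Nat.exists_eq_add_of_le' (show α ≤ a by omega)
  obtain ⟨b, rfl⟩ := Nat.exists_eq_add_of_le' (show β ≤ b by omega)
  obtain ⟨S, hS, hS₀, hd'⟩ := exists_standard (y := y) hxo hx (a := a) (b := b) (by omega)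
  refine hasLinearRealization_of_glue hS hS₀ hG hG₀ ?_
  rw [hd, hd', mset3_add, zero_add]
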